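/- arXiv:1810.11310 — 2 statements merged into one kernel-verified Lean document; each statement's English description precedes it below -/
import Mathlib

section
/- Let R = [[0,-1],[1,0]] (counterclockwise quarter-turn) and T = σ₀. Then σ₀·σ₃⁻¹·σ₀·σ₃⁻¹·σ₀ = R, and moreover σ₁ = T·R·T, σ₂ = T·R·T·R·T, and σ₃ = T·R·T·R·T·R·T. -/
noncomputable section
open Matrix

noncomputable def φ : ℝ := (1 + Real.sqrt 5) / 2

noncomputable def σ : Fin 4 → Matrix (Fin 2) (Fin 2) ℝ
  | 0 => !![1, φ; 0, 1]
  | 1 => !![φ, φ; 1, φ]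
  | 2 => !![φ, 1; φ, φ]
  | 3 => !![1, 0; φ, 1]

/-- Counterclockwise quarter-turn rotation. -/
noncomputable def R : Matrix (Fin 2) (Fin 2) ℝ := !![0, -1; 1, 0]

/-- T = σ₀. -/
noncomputable def T : Matrix (Fin 2) (Fin 2) ℝ := σ 0

theorem phi_sq : φ * φ = φ + 1 := by
  have h : Real.sqrt 5 * Real.sqrt 5 = 5 := Real.mul_self_sqrt (by norm_num)
  unfold φ
  linarith

theorem sigma3_inv : (σ 3)⁻¹ = !![1, 0; -φ, 1] := by
  apply Matrix.inv_eq_right_inv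
  simp [σ, Matrix.one_fin_two]

theorem h01 : σ 0 * (σ 3)⁻¹ = !![-φ, φ; -φ, 1] := by
  rw [sigma3_inv]
  have h := phi_sq
  simp [σ]
  linarith

theorem hTR : T * R = !![φ, -1; 1, 0] := by
  simp [T, R, σ]

theorem hs1 : σ 1 = T * R * T := by
  have h := phi_sq
  rw [hTR]
  simp [σ, T]
  linarith

theorem hs2 : σ 2 = T * R * σ 1 := by
  have h := phi_sq
  rw [hTR]
  simp [σ]
  constructor <;> linarith

theorem hs3 : σ 3 = T * R * σ 2 := by
  have h := phi_sq
  rw [hTR]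
  simp [σ]
  linarith

theorem stmt1 :
    σ 0 * (σ 3)⁻¹ * σ 0 * (σ 3)⁻¹ * σ 0 = R ∧
    σ 1 = T * R * T ∧
    σ 2 = T * R * T * R * T ∧
    σ 3 = T * R * T * R * T * R * T := by
  have h2 : σ 2 = T * R * T * R * T := by
    rw [hs2, hs1]; simp only [Matrix.mul_assoc]
  refine ⟨?_, hs1, h2, ?_⟩
  · have h := phi_sq
    rw [Matrix.mul_assoc (σ 0 * (σ 3)⁻¹), h01]
    simp [σ, R]
    grind
  · rw [hs3, h2]; simp only [Matrix.mul_assoc]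
end
end

section
/- For every integer k ≥ 1, the vector (kφ, 1)ᵀ equals v(w) for the normalized word w = 0^{k-1}1 of length k, and (kφ, 1)ᵀ ≠ v(w') for every normalized word w' of length different from k. In particular, for any real N ≥ φ, the vector (⌊N/φ⌋·φ, 1)ᵀ lies in the square [0,N]² and its unique normalized word has length ⌊N/φ⌋, so obtaining all vectors v(w) in [0,N]² requires normalized words of length at least ⌊N/φ⌋. -/
noncomputable section
open Matrix

abbrev Word := List (Fin 4)

noncomputable def vword (w : Word) : Fin 2 → ℝ := ((w.map σ).prod).mulVec ![1, 0]

def Normalized (w : Word) : Prop := ∀ h : w ≠ [], w.getLast h ≠ 0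

theorem aux_phi : 1 < φ := by
  have h : (1:ℝ) < Real.sqrt 5 := by
    rw [Real.lt_sqrt] <;> norm_num
  unfold φ
  linarith

theorem aux_nil0 : vword [] 0 = 1 := by simp [vword]
theorem aux_nil1 : vword [] 1 = 0 := by simp [vword]

theorem aux_cons (a : Fin 4) (w : Word) : vword (a :: w) = (σ a).mulVec (vword w) := by
  simp only [vword, List.map_cons, List.prod_cons, Matrix.mulVec_mulVec]

theorem aux_c0 (a : Fin 4) (w : Word) :
    vword (a :: w) 0 = σ a 0 0 * vword w 0 + σ a 0 1 * vword w 1 := by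
  rw [aux_cons]; simp [Matrix.mulVec, dotProduct, Fin.sum_univ_two]

theorem aux_c1 (a : Fin 4) (w : Word) :
    vword (a :: w) 1 = σ a 1 0 * vword w 0 + σ a 1 1 * vword w 1 := by
  rw [aux_cons]; simp [Matrix.mulVec, dotProduct, Fin.sum_univ_two]

theorem aux_pos (w : Word) : 1 ≤ vword w 0 ∧ 0 ≤ vword w 1 := by
  have hp := aux_phi
  induction w with
  | nil => rw [aux_nil0, aux_nil1]; norm_num
  | cons a w ih =>
    obtain ⟨h0, h1⟩ := ih
    have h2 : 0 ≤ φ * vword w 1 := by positivity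
    have h3 : 0 ≤ (φ - 1) * (vword w 0 - 1) :=
      mul_nonneg (by linarith) (by linarith)
    rw [aux_c0, aux_c1]
    fin_cases a <;> simp [σ] <;> constructor <;> nlinarith

theorem aux_norm {a : Fin 4} {w : Word} (h : Normalized (a :: w)) : Normalized w := by
  intro hw
  have := h (by simp)
  rwa [List.getLast_cons hw] at this

theorem aux_ge (w : Word) (hn : Normalized w) (hw : w ≠ []) : 1 ≤ vword w 1 := by
  have hp := aux_phi
  induction w with
  | nil => exact absurd rfl hw
  | cons a w ih =>
    obtain ⟨h0, h1⟩ := aux_pos w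
    have h2 : 0 ≤ φ * vword w 1 := by positivity
    have h3 : 0 ≤ (φ - 1) * (vword w 0 - 1) :=
      mul_nonneg (by linarith) (by linarith)
    rw [aux_c1]
    by_cases ha : a = 0
    · subst ha
      have hw' : w ≠ [] := by
        rintro rfl
        exact hn (by simp) (by simp)
      have := ih (aux_norm hn) hw'
      simpa [σ] using this
    · fin_cases a <;> simp [σ] at ha ⊢ <;> nlinarith

theorem aux_main (w : Word) (hn : Normalized w) (hy : vword w 1 = 1) :
    vword w 0 = w.length * φ := by
  have hp := aux_phi
  induction w with
  | nil => rw [aux_nil1] at hy; norm_num at hy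
  | cons a w ih =>
    obtain ⟨h0, h1⟩ := aux_pos w
    have h2 : 0 ≤ φ * vword w 1 := by positivity
    have h3 : 0 ≤ (φ - 1) * (vword w 0 - 1) :=
      mul_nonneg (by linarith) (by linarith)
    rw [aux_c1] at hy
    rw [aux_c0]
    fin_cases a
    · simp [σ] at hy ⊢
      rw [ih (aux_norm hn) hy, hy]; ring
    · simp [σ] at hy ⊢
      by_cases hw : w = []
      · subst hw; rw [aux_nil0, aux_nil1]; simp
      · have := aux_ge w (aux_norm hn) hw
        exfalso; nlinarith
    · simp [σ] at hy
      exfalso; nlinarith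
    · simp [σ] at hy
      exfalso; nlinarith

theorem aux_len (w : Word) (hn : Normalized w) (k : ℕ) (h : vword w = ![(k : ℝ) * φ, 1]) :
    w.length = k := by
  have hp := aux_phi
  have hp0 : 0 < φ := by linarith
  have h1 := aux_main w hn (by rw [h]; simp)
  rw [h] at h1
  simp only [Matrix.cons_val_zero] at h1
  have := mul_right_cancel₀ (by positivity : φ ≠ 0) h1
  exact_mod_cast this.symm

theorem aux_rep (n : ℕ) :
    vword (List.replicate n 0 ++ [1]) = ![((n + 1 : ℕ) : ℝ) * φ, 1] := by
  induction n with
  | zero =>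
    ext i; fin_cases i
    · simp [aux_c0, aux_nil0, aux_nil1, σ]
    · simp [aux_c1, aux_nil0, aux_nil1, σ]
  | succ n ih =>
    rw [List.replicate_succ, List.cons_append, aux_cons, ih]
    ext i; fin_cases i
    · simp [σ, Matrix.mulVec, dotProduct, Fin.sum_univ_two]; ring
    · simp [σ, Matrix.mulVec, dotProduct, Fin.sum_univ_two]

theorem stmt19 :
    (∀ k : ℕ, 1 ≤ k →
      Normalized (List.replicate (k - 1) 0 ++ [1]) ∧
      (List.replicate (k - 1) (0 : Fin 4) ++ [1]).length = k ∧
      vword (List.replicate (k - 1) 0 ++ [1]) = ![(k : ℝ) * φ, 1] ∧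
      ∀ w' : Word, Normalized w' → w'.length ≠ k →
        vword w' ≠ ![(k : ℝ) * φ, 1]) ∧
    ∀ N : ℝ, φ ≤ N →
      ((0 : ℝ) ≤ (⌊N / φ⌋₊ : ℝ) * φ ∧ (⌊N / φ⌋₊ : ℝ) * φ ≤ N ∧
        (0 : ℝ) ≤ 1 ∧ (1 : ℝ) ≤ N) ∧
      ∀ w : Word, Normalized w → vword w = ![(⌊N / φ⌋₊ : ℝ) * φ, 1] →
        w.length = ⌊N / φ⌋₊ := by
  have hp := aux_phi
  have hp0 : 0 < φ := by linarith
  refine ⟨fun k hk => ⟨?_, ?_, ?_, ?_⟩, fun N hN => ⟨⟨by positivity, ?_, by norm_num, by linarith⟩, ?_⟩⟩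
  · intro h; simp
  · simp; omega
  · rw [aux_rep, Nat.sub_add_cancel hk]
  · intro w' hn hl he
    exact hl (aux_len w' hn k he)
  · have : (⌊N / φ⌋₊ : ℝ) ≤ N / φ := Nat.floor_le (by apply div_nonneg <;> linarith)
    rwa [le_div_iff₀ hp0] at this
  · intro w hn h
    exact aux_len w hn _ h
end
end
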